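/- arXiv:1506.08294 — 2 statements merged into one kernel-verified Lean document; each statement's English description precedes it below -/
import Mathlib

section
/- Let N ≥ 3 be an integer and α ∈ (0,2). Let u : ℝ^N → ℝ be continuous, locally bounded, with ∫_{ℝ^N} |u(y)|·(1+|y|)^{-(N+α)} dy < ∞, and suppose u satisfies the spherical sub-mean-value inequality: for every x ∈ ℝ^N and every r > 0, the average of u over the sphere {y : |y−x| = r} with respect to the (N−1)-dimensional surface (Hausdorff) measure is at most u(x). Then for every x ∈ ℝ^N and every ε > 0 the function z ↦ (u(x+z) − u(x))·|z|^{−(N+α)} is Lebesgue integrable on {z ∈ ℝ^N : |z| ≥ ε} and ∫_{|z|≥ε} (u(x+z) − u(x))·|z|^{−(N+α)} dz ≤ 0. -/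
open MeasureTheory Real Filter Topology

noncomputable section

/-- The measure of balls of a fixed radius being constant forces those balls to be non-null. -/
lemma measure_ball_pos_of_uniform {X : Type*} [MetricSpace X] [CompactSpace X]
    [MeasurableSpace X] [BorelSpace X] (μ : Measure X) (hμ0 : μ ≠ 0)
    (hμ : ∀ (x y : X) (r : ℝ), μ (Metric.ball x r) = μ (Metric.ball y r))
    (x : X) {r : ℝ} (hr : 0 < r) : 0 < μ (Metric.ball x r) := by
  rw [pos_iff_ne_zero]
  intro h0
  obtain ⟨t, ht, hcov⟩ :=
    Metric.totallyBounded_iff.1 (isCompact_univ (X := X)).totallyBounded r hr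
  apply hμ0
  rw [← Measure.measure_univ_eq_zero]
  refine measure_mono_null hcov ((measure_biUnion_null_iff ht.countable).2 fun y _ => ?_)
  rw [hμ y x, h0]

/-- Two finite measures on a compact metric space for which balls of equal radius have equal
measure induce the same averages of continuous functions. -/
lemma average_eq_average_of_uniform {X : Type*} [MetricSpace X] [CompactSpace X]
    [MeasurableSpace X] [BorelSpace X] (μ ν : Measure X) [IsFiniteMeasure μ] [IsFiniteMeasure ν]
    (hμ0 : μ ≠ 0) (hν0 : ν ≠ 0)
    (hμ : ∀ (x y : X) (r : ℝ), μ (Metric.ball x r) = μ (Metric.ball y r))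
    (hν : ∀ (x y : X) (r : ℝ), ν (Metric.ball x r) = ν (Metric.ball y r))
    {f : X → ℝ} (hf : Continuous f) : ⨍ x, f x ∂μ = ⨍ x, f x ∂ν := by
  rw [← sub_eq_zero, ← abs_nonpos_iff]
  refine le_of_forall_pos_le_add fun δ hδ => ?_
  rw [zero_add]
  obtain ⟨r, hr, hfr⟩ :=
    Metric.uniformContinuous_iff.1 (CompactSpace.uniformContinuous_of_continuous hf) δ hδ
  have hne : Nonempty X := by
    by_contra h
    rw [not_nonempty_iff] at h
    exact hμ0 (Measure.eq_zero_of_isEmpty μ)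
  obtain ⟨x₀⟩ := hne
  set p := μ.real (Metric.ball x₀ r) with hp
  set q := ν.real (Metric.ball x₀ r) with hq
  have hp0 : 0 < p :=
    ENNReal.toReal_pos (measure_ball_pos_of_uniform μ hμ0 hμ x₀ hr).ne' (measure_ne_top _ _)
  have hq0 : 0 < q :=
    ENNReal.toReal_pos (measure_ball_pos_of_uniform ν hν0 hν x₀ hr).ne' (measure_ne_top _ _)
  have hm0 : 0 < μ.real Set.univ :=
    ENNReal.toReal_pos (Measure.measure_univ_ne_zero.2 hμ0) (measure_ne_top _ _)
  set A : Set (X × X) := {z | dist z.1 z.2 < r} with hA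
  have hAm : MeasurableSet A := (isOpen_lt (by fun_prop) continuous_const).measurableSet
  have hint : ∀ g : X × X → ℝ, Continuous g → Integrable g (μ.prod ν) := fun g hg =>
    hg.integrable_of_hasCompactSupport (HasCompactSupport.of_compactSpace g)
  have key1 : ∀ g : X → ℝ, Continuous g →
      ∫ z in A, g z.1 ∂(μ.prod ν) = q * ∫ x, g x ∂μ := by
    intro g hg
    rw [← integral_indicator hAm, integral_prod _ ((hint _ (by fun_prop)).indicator hAm),
      ← integral_const_mul]
    congr 1
    ext x
    have : ∀ y, A.indicator (fun z : X × X => g z.1) (x, y)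
        = (Metric.ball x r).indicator (fun _ => g x) y := by
      intro y
      simp only [Set.indicator, hA, Set.mem_ofPred_eq, Metric.mem_ball, dist_comm]
    simp only [this]
    rw [integral_indicator Metric.isOpen_ball.measurableSet, setIntegral_const, smul_eq_mul,
      hq, Measure.real, Measure.real, hν x x₀]
  have key2 : ∀ g : X → ℝ, Continuous g →
      ∫ z in A, g z.2 ∂(μ.prod ν) = p * ∫ x, g x ∂ν := by
    intro g hg
    rw [← integral_indicator hAm, integral_prod_symm _ ((hint _ (by fun_prop)).indicator hAm),
      ← integral_const_mul]
    congr 1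
    ext y
    have : ∀ x, A.indicator (fun z : X × X => g z.2) (x, y)
        = (Metric.ball y r).indicator (fun _ => g y) x := by
      intro x
      simp only [Set.indicator, hA, Set.mem_ofPred_eq, Metric.mem_ball]
    simp only [this]
    rw [integral_indicator Metric.isOpen_ball.measurableSet, setIntegral_const, smul_eq_mul,
      hp, Measure.real, Measure.real, hμ y x₀]
  have hmass : q * μ.real Set.univ = p * ν.real Set.univ := by
    have h1 := key1 (fun _ => 1) continuous_const
    have h2 := key2 (fun _ => 1) continuous_const
    rw [h1] at h2
    simpa using h2
  have hAmass : (μ.prod ν).real A = q * μ.real Set.univ := by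
    have h1 := key1 (fun _ => 1) continuous_const
    simpa using h1
  have hdiff : |q * ∫ x, f x ∂μ - p * ∫ x, f x ∂ν| ≤ δ * (q * μ.real Set.univ) := by
    rw [← key1 f hf, ← key2 f hf, ← integral_sub (hint _ (by fun_prop)).integrableOn
      (hint _ (by fun_prop)).integrableOn, ← hAmass, ← Real.norm_eq_abs]
    refine norm_setIntegral_le_of_norm_le_const (measure_lt_top _ _) fun z hz => ?_
    exact (hfr hz).le
  have hn0 : 0 < ν.real Set.univ :=
    ENNReal.toReal_pos (Measure.measure_univ_ne_zero.2 hν0) (measure_ne_top _ _)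
  rw [average_eq, average_eq, smul_eq_mul, smul_eq_mul]
  have e : (μ.real Set.univ)⁻¹ * ∫ x, f x ∂μ - (ν.real Set.univ)⁻¹ * ∫ x, f x ∂ν
      = (q * ∫ x, f x ∂μ - p * ∫ x, f x ∂ν) / (q * μ.real Set.univ) := by
    rw [sub_div]
    congr 1
    · field_simp
    · rw [hmass]; field_simp
  rw [e, abs_div, abs_of_pos (mul_pos hq0 hm0), div_le_iff₀ (mul_pos hq0 hm0)]
  exact hdiff

section Sphere
open Metric Module
open scoped Pointwise
variable {E : Type*} [NormedAddCommGroup E] [InnerProductSpace ℝ E]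

lemma exists_linearIsometryEquiv_apply_eq {x y : E} (h : ‖x‖ = ‖y‖) :
    ∃ g : E ≃ₗᵢ[ℝ] E, g x = y :=
  ⟨(ℝ ∙ (x - y))ᗮ.reflection, Submodule.reflection_sub h⟩

lemma LinearIsometryEquiv.image_sphere_ball (g : E ≃ₗᵢ[ℝ] E) (x y : sphere (0 : E) 1)
    (h : g x = y) (r : ℝ) :
    g '' ((↑) '' ball x r) = ((↑) '' ball y r : Set E) := by
  ext z
  simp only [Set.mem_image, mem_ball, Subtype.exists, exists_and_right, exists_eq_right,
    mem_sphere_zero_iff_norm, Subtype.dist_eq, exists_prop]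
  constructor
  · rintro ⟨w, ⟨hw, hd⟩, rfl⟩
    rw [← h, g.dist_map, g.norm_map]
    exact ⟨hw, hd⟩
  · rintro ⟨hz, hd⟩
    refine ⟨g.symm z, ⟨by simpa using hz, ?_⟩, by simp⟩
    rwa [← g.dist_map, g.apply_symm_apply, h]

variable [MeasurableSpace E] [BorelSpace E]

lemma hausdorffMeasure_sphere_ball_eq {d : ℝ} (hd : 0 ≤ d) (x y : sphere (0 : E) 1) (r : ℝ) :
    μH[d] (ball x r) = μH[d] (ball y r) := by
  obtain ⟨g, hg⟩ := exists_linearIsometryEquiv_apply_eq (x := (x : E)) (y := y) (by simp)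
  have hiso : Isometry ((↑) : sphere (0 : E) 1 → E) := isometry_subtype_coe
  rw [← hiso.hausdorffMeasure_image (Or.inl hd),
    ← hiso.hausdorffMeasure_image (Or.inl hd) (ball y r), ← g.image_sphere_ball x y hg r,
    g.isometry.hausdorffMeasure_image (Or.inl hd)]

variable [FiniteDimensional ℝ E]

lemma toSphere_ball_eq (x y : sphere (0 : E) 1) (r : ℝ) :
    (volume : Measure E).toSphere (ball x r) = (volume : Measure E).toSphere (ball y r) := by
  obtain ⟨g, hg⟩ := exists_linearIsometryEquiv_apply_eq (x := (x : E)) (y := y) (by simp)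
  rw [Measure.toSphere_apply' _ isOpen_ball.measurableSet,
    Measure.toSphere_apply' _ isOpen_ball.measurableSet, ← g.image_sphere_ball x y hg r]
  have : Set.Ioo (0 : ℝ) 1 • (g '' ((↑) '' ball x r))
      = g '' (Set.Ioo (0 : ℝ) 1 • ((↑) '' ball x r : Set E)) := by
    rw [← Set.image2_smul, ← Set.image2_smul, Set.image_image2, Set.image2_image_right]
    simp
  rw [this, LinearIsometryEquiv.image_eq_preimage_symm,
    g.symm.measurePreserving.measure_preimage_emb g.symm.toHomeomorph.measurableEmbedding]

lemma hausdorffMeasure_sphere_ne_top {n : ℕ} [Fact (finrank ℝ E = n + 1)] :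
    μH[(n : ℝ)] (sphere (0 : E) 1) ≠ ⊤ := by
  have : Nontrivial E := nontrivial_of_finrank_pos (R := ℝ) (by
    rw [(Fact.out : finrank ℝ E = n + 1)]; omega)
  obtain ⟨v, hv⟩ := exists_norm_eq E zero_le_one
  have hv0 : v ≠ 0 := by rintro rfl; simp at hv
  set H : Set E := {x | x ∈ sphere (0 : E) 1 ∧ innerSL ℝ v x ≤ 0} with hH
  have hHc : IsCompact H :=
    (isCompact_sphere (0 : E) 1).inter_right (isClosed_le (innerSL ℝ v).continuous continuous_const)
  have hHfin : μH[(n : ℝ)] H ≠ ⊤ := by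
    have hK : IsCompact (stereoToFun v '' H) := by
      refine hHc.image_of_continuousOn (continuousOn_stereoToFun.mono fun x hx => ?_)
      exact (hx.2.trans_lt one_pos).ne
    have hloc : LocallyLipschitz (stereoInvFunAux v ∘ ((↑) : (ℝ ∙ v)ᗮ → E)) :=
      ((contDiff_stereoInvFunAux (m := 1)).comp
        (ℝ ∙ v)ᗮ.subtypeL.contDiff).locallyLipschitz
    obtain ⟨K, hL⟩ := hloc.locallyLipschitzOn.exists_lipschitzOnWith_of_compact hK
    have hsub : H ⊆ (stereoInvFunAux v ∘ ((↑) : (ℝ ∙ v)ᗮ → E)) '' (stereoToFun v '' H) := by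
      intro x hx
      refine ⟨_, ⟨x, hx, rfl⟩, ?_⟩
      have hxv : x ≠ v := by
        rintro rfl
        have := hx.2
        simp [hv] at this
        linarith
      exact congrArg Subtype.val (stereo_left_inv hv (x := ⟨x, hx.1⟩) hxv)
    have hfin : μH[(n : ℝ)] (stereoToFun v '' H) ≠ ⊤ := by
      have := hK.measure_ne_top (μ := μH[finrank ℝ (ℝ ∙ v)ᗮ])
      rwa [Submodule.finrank_orthogonal_span_singleton (n := n) hv0] at this
    refine ne_top_of_le_ne_top ?_ ((measure_mono hsub).trans
      (hL.hausdorffMeasure_image_le n.cast_nonneg))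
    exact ENNReal.mul_ne_top (ENNReal.rpow_ne_top_of_nonneg n.cast_nonneg ENNReal.coe_ne_top) hfin
  have hcov : sphere (0 : E) 1 ⊆ H ∪ (LinearIsometryEquiv.neg ℝ : E ≃ₗᵢ[ℝ] E) '' H := by
    intro x hx
    rcases le_total (innerSL ℝ v x) 0 with h | h
    · exact Or.inl ⟨hx, h⟩
    · exact Or.inr ⟨-x, ⟨by simpa using hx, by simpa using h⟩, by simp⟩
  refine ne_top_of_le_ne_top ?_ ((measure_mono hcov).trans (measure_union_le _ _))
  rw [(LinearIsometryEquiv.neg ℝ : E ≃ₗᵢ[ℝ] E).isometry.hausdorffMeasure_image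
    (Or.inl n.cast_nonneg)]
  exact ENNReal.add_ne_top.2 ⟨hHfin, hHfin⟩

lemma hausdorffMeasure_sphere_ne_zero {n : ℕ} [Fact (finrank ℝ E = n + 1)] :
    μH[(n : ℝ)] (sphere (0 : E) 1) ≠ 0 := by
  have : Nontrivial E := nontrivial_of_finrank_pos (R := ℝ) (by
    rw [(Fact.out : finrank ℝ E = n + 1)]; omega)
  obtain ⟨v, hv⟩ := exists_norm_eq E zero_le_one
  have hv0 : v ≠ 0 := by rintro rfl; simp at hv
  have hsub : ball (0 : (ℝ ∙ v)ᗮ) 1 ⊆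
      (ℝ ∙ v)ᗮ.orthogonalProjectionOnto '' sphere (0 : E) 1 := by
    intro w hw
    rw [mem_ball_zero_iff] at hw
    have hvw : inner ℝ (w : E) v = 0 := Submodule.mem_orthogonal_singleton_iff_inner_left.mp w.2
    refine ⟨w + √(1 - ‖w‖ ^ 2) • v, ?_, ?_⟩
    · have h1 : 0 ≤ 1 - ‖w‖ ^ 2 := by nlinarith [norm_nonneg w]
      rw [mem_sphere_zero_iff_norm, ← sq_eq_sq₀ (norm_nonneg _) zero_le_one, norm_add_sq_real,
        inner_smul_right, hvw, norm_smul, hv, Real.norm_eq_abs, mul_one, sq_abs, Real.sq_sqrt h1]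
      simp
    · rw [map_add, map_smul,
        Submodule.orthogonalProjectionOnto_orthogonalComplement_singleton_eq_zero]
      simp
  have hpos : 0 < μH[(n : ℝ)] (ball (0 : (ℝ ∙ v)ᗮ) 1) := by
    have := isOpen_ball.measure_pos μH[finrank ℝ (ℝ ∙ v)ᗮ]
      ⟨0, mem_ball_self (x := (0 : (ℝ ∙ v)ᗮ)) one_pos⟩
    rwa [Submodule.finrank_orthogonal_span_singleton (n := n) hv0] at this
  exact (hpos.trans_le ((measure_mono hsub).trans
    (hausdorffMeasure_orthogonalProjectionOnto_le _ _ _ n.cast_nonneg))).ne'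

lemma setAverage_sphere_eq {d : ℝ} (hd : 0 ≤ d) (f : E → ℝ) (x : E) {r : ℝ} (hr : 0 < r) :
    ⨍ y in sphere x r, f y ∂μH[d] = ⨍ ω : sphere (0 : E) 1, f (x + r • (ω : E)) ∂μH[d] := by
  set φ : sphere (0 : E) 1 → E := fun ω => x + r • (ω : E) with hφ
  have hemb : MeasurableEmbedding φ := by
    refine (Continuous.isClosedEmbedding (by fun_prop) fun a b hab => ?_).measurableEmbedding
    exact Subtype.ext (smul_right_injective E hr.ne' (add_left_cancel hab))
  have himg : ∀ s : Set (sphere (0 : E) 1), φ '' s = x +ᵥ (r • ((↑) '' s : Set E)) := by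
    intro s
    simp only [hφ, ← Set.image_smul, ← Set.image_vadd, Set.image_image, vadd_eq_add]
  have hrange : Set.range φ = sphere x r := by
    rw [← Set.image_univ, himg, Set.image_univ, Subtype.range_coe, smul_sphere' hr.ne']
    simp [abs_of_pos hr]
  have hcomap : Measure.comap φ μH[d] = (‖r‖₊ ^ d) • μH[d] := by
    ext s hs
    rw [hemb.comap_apply, himg, hausdorffMeasure_vadd _ (Or.inl hd),
      Measure.hausdorffMeasure_smul₀ hd hr.ne',
      isometry_subtype_coe.hausdorffMeasure_image (Or.inl hd)]
    rfl
  have hc : ((‖r‖₊ ^ d : NNReal) : ℝ) ≠ 0 := by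
    have : 0 < ‖r‖₊ ^ d := NNReal.rpow_pos (by simpa using hr.ne')
    exact_mod_cast this.ne'
  rw [← hrange, ← hemb.map_comap, hcomap, average_eq, average_eq, hemb.integral_map,
    integral_smul_nnreal_measure, Measure.real, Measure.map_apply hemb.measurable .univ,
    Set.preimage_univ, ← Measure.real, measureReal_nnreal_smul_apply, NNReal.smul_def,
    smul_eq_mul, smul_eq_mul, smul_eq_mul, mul_inv]
  field_simp
  rfl

lemma average_hausdorffMeasure_sphere_eq_toSphere {n : ℕ} [Fact (finrank ℝ E = n + 1)]
    {f : sphere (0 : E) 1 → ℝ} (hf : Continuous f) :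
    ⨍ ω, f ω ∂μH[(n : ℝ)] = ⨍ ω, f ω ∂(volume : Measure E).toSphere := by
  have : Nontrivial E := nontrivial_of_finrank_pos (R := ℝ) (by
    rw [(Fact.out : finrank ℝ E = n + 1)]; omega)
  have huniv : (μH[(n : ℝ)] : Measure (sphere (0 : E) 1)) Set.univ =
      μH[(n : ℝ)] (sphere (0 : E) 1) := by
    rw [← isometry_subtype_coe.hausdorffMeasure_image (Or.inl n.cast_nonneg), Set.image_univ,
      Subtype.range_coe]
  have : IsFiniteMeasure (μH[(n : ℝ)] : Measure (sphere (0 : E) 1)) :=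
    ⟨by rw [huniv]; exact hausdorffMeasure_sphere_ne_top.lt_top⟩
  refine average_eq_average_of_uniform _ _ ?_ (Measure.toSphere_ne_zero _)
    (hausdorffMeasure_sphere_ball_eq n.cast_nonneg) toSphere_ball_eq hf
  rw [← Measure.measure_univ_ne_zero, huniv]
  exact hausdorffMeasure_sphere_ne_zero

lemma integral_nonpos_of_integral_toSphere_nonpos [Nontrivial E] {g : E → ℝ} (hg : Integrable g)
    (h : ∀ r : ℝ, 0 < r →
      ∫ ω : sphere (0 : E) 1, g (r • (ω : E)) ∂(volume : Measure E).toSphere ≤ 0) :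
    ∫ z, g z ≤ 0 := by
  have hmp := (volume : Measure E).measurePreserving_homeomorphUnitSphereProd
  have hme := (homeomorphUnitSphereProd E).measurableEmbedding
  have hcomp : ∀ z : ({0}ᶜ : Set E), g z = (fun p : sphere (0 : E) 1 × Set.Ioi (0 : ℝ) =>
      g ((p.2 : ℝ) • (p.1 : E))) (homeomorphUnitSphereProd E z) := by
    intro z
    have := congrArg Subtype.val ((homeomorphUnitSphereProd E).symm_apply_apply z)
    rw [homeomorphUnitSphereProd_symm_apply_coe] at this
    exact congrArg g this.symm
  have hint : Integrable (fun p : sphere (0 : E) 1 × Set.Ioi (0 : ℝ) => g ((p.2 : ℝ) • (p.1 : E)))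
      ((volume : Measure E).toSphere.prod (Measure.volumeIoiPow (finrank ℝ E - 1))) := by
    rw [← hmp.integrable_comp_emb hme]
    have := (integrableOn_iff_comap_subtypeVal (measurableSet_singleton (0 : E)).compl).1
      hg.integrableOn
    exact this.congr (.of_forall hcomp)
  rw [← restrict_compl_singleton (μ := volume) (0 : E),
    ← integral_subtype_comap (measurableSet_singleton _).compl]
  have hpolar := hmp.integral_comp hme (fun p : sphere (0 : E) 1 × Set.Ioi (0 : ℝ) =>
    g ((p.2 : ℝ) • (p.1 : E)))
  rw [integral_congr_ae (.of_forall hcomp)]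
  refine hpolar.trans_le ?_
  rw [integral_prod_symm _ hint]
  exact integral_nonpos fun r => h r r.2

end Sphere

lemma one_add_norm_add_le {E : Type*} [NormedAddCommGroup E] {x z : E} {ε : ℝ} (hε : 0 < ε)
    (hz : ε ≤ ‖z‖) : 1 + ‖x + z‖ ≤ ((1 + ‖x‖) / ε + 1) * ‖z‖ := by
  have h1 := norm_add_le x z
  have h2 : 1 + ‖x‖ ≤ (1 + ‖x‖) / ε * ‖z‖ := by
    rw [div_mul_eq_mul_div, le_div_iff₀ hε]
    gcongr
  linarith

lemma rpow_norm_inv_le {E : Type*} [NormedAddCommGroup E] (x : E) {z : E} {ε β : ℝ} (hε : 0 < ε)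
    (hβ : 0 ≤ β) (hz : ε ≤ ‖z‖) :
    (‖z‖ ^ β)⁻¹ ≤ ((1 + ‖x‖) / ε + 1) ^ β * (1 + ‖x + z‖) ^ (-β) := by
  have hz0 : 0 < ‖z‖ := hε.trans_le hz
  have hpos : 0 < 1 + ‖x + z‖ := by positivity
  rw [Real.rpow_neg hpos.le, ← div_eq_mul_inv, inv_le_iff_one_le_mul₀ (by positivity),
    div_mul_eq_mul_div, one_le_div (by positivity),
    ← Real.mul_rpow (by positivity) hz0.le]
  exact Real.rpow_le_rpow hpos.le (one_add_norm_add_le hε hz) hβ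

/-- A continuous, locally bounded function satisfying the spherical
sub-mean-value inequality has nonpositive truncated fractional-Laplacian integrals. -/
theorem stmt0 (N : ℕ) (hN : 3 ≤ N) (α : ℝ) (hα1 : 0 < α) (hα2 : α < 2)
    (u : EuclideanSpace ℝ (Fin N) → ℝ)
    (hu_cont : Continuous u)
    (hu_locb : ∀ R : ℝ, ∃ M : ℝ, ∀ x : EuclideanSpace ℝ (Fin N), ‖x‖ ≤ R → |u x| ≤ M)
    (hu_int : Integrable (fun y : EuclideanSpace ℝ (Fin N) =>
      |u y| * (1 + ‖y‖) ^ (-((N : ℝ) + α))))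
    (hu_submean : ∀ (x : EuclideanSpace ℝ (Fin N)) (r : ℝ), 0 < r →
      ⨍ y in Metric.sphere x r, u y ∂(μH[(N : ℝ) - 1]) ≤ u x) :
    ∀ (x : EuclideanSpace ℝ (Fin N)) (ε : ℝ), 0 < ε →
      IntegrableOn (fun z : EuclideanSpace ℝ (Fin N) =>
          (u (x + z) - u x) / ‖z‖ ^ ((N : ℝ) + α))
        {z : EuclideanSpace ℝ (Fin N) | ε ≤ ‖z‖} ∧
      (∫ z in {z : EuclideanSpace ℝ (Fin N) | ε ≤ ‖z‖},
          (u (x + z) - u x) / ‖z‖ ^ ((N : ℝ) + α)) ≤ 0 := by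
  intro x ε hε
  obtain ⟨n, rfl⟩ : ∃ n, N = n + 1 := ⟨N - 1, by omega⟩
  have : Fact (Module.finrank ℝ (EuclideanSpace ℝ (Fin (n + 1))) = n + 1) := ⟨by simp⟩
  set β : ℝ := ((n + 1 : ℕ) : ℝ) + α with hβdef
  have hβ : 0 ≤ β := by positivity
  set A : Set (EuclideanSpace ℝ (Fin (n + 1))) := {z | ε ≤ ‖z‖} with hA
  have hAm : MeasurableSet A := (isClosed_le continuous_const continuous_norm).measurableSet
  set C : ℝ := ((1 + ‖x‖) / ε + 1) ^ β with hC
  have hdom : Integrable fun z : EuclideanSpace ℝ (Fin (n + 1)) =>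
      C * (|u (x + z)| * (1 + ‖x + z‖) ^ (-β) + |u x| * (1 + ‖x + z‖) ^ (-β)) := by
    refine ((hu_int.comp_add_left x).add (Integrable.const_mul ?_ _)).const_mul C
    refine Integrable.comp_add_left (f := fun z => (1 + ‖z‖) ^ (-β)) ?_ x
    refine integrable_one_add_norm ?_
    rw [Fact.out (p := Module.finrank ℝ (EuclideanSpace ℝ (Fin (n + 1))) = n + 1)]
    linarith
  have hint : IntegrableOn (fun z => (u (x + z) - u x) / ‖z‖ ^ β) A := by
    refine hdom.integrableOn.mono' (Measurable.aestronglyMeasurable (by fun_prop)) ?_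
    filter_upwards [ae_restrict_mem hAm] with z hz
    have hle := rpow_norm_inv_le x hε hβ hz
    rw [Real.norm_eq_abs, abs_div, abs_of_nonneg (Real.rpow_nonneg (norm_nonneg z) β),
      div_eq_mul_inv]
    calc |u (x + z) - u x| * (‖z‖ ^ β)⁻¹
        ≤ (|u (x + z)| + |u x|) * (C * (1 + ‖x + z‖) ^ (-β)) := by
          gcongr
          exact abs_sub _ _
      _ = _ := by ring
  refine ⟨hint, ?_⟩
  rw [← integral_indicator hAm]
  refine integral_nonpos_of_integral_toSphere_nonpos ((integrable_indicator_iff hAm).2 hint)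
    fun r hr => ?_
  by_cases hrε : ε ≤ r
  swap
  · refine (integral_eq_zero_of_ae (.of_forall fun ω => ?_)).le
    refine Set.indicator_of_notMem ?_ _
    simpa [hA, norm_smul, abs_of_pos hr] using hrε
  have hval : ∀ ω : Metric.sphere (0 : EuclideanSpace ℝ (Fin (n + 1))) 1,
      A.indicator (fun z => (u (x + z) - u x) / ‖z‖ ^ β) (r • (ω : EuclideanSpace ℝ (Fin (n + 1))))
        = (u (x + r • (ω : EuclideanSpace ℝ (Fin (n + 1)))) - u x) / r ^ β := by
    intro ω
    have hn : ‖r • (ω : EuclideanSpace ℝ (Fin (n + 1)))‖ = r := by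
      simp [norm_smul, abs_of_pos hr]
    rw [Set.indicator_of_mem (by simpa [hA, hn] using hrε), hn]
  simp_rw [hval]
  rw [integral_div]
  refine div_nonpos_of_nonpos_of_nonneg ?_ (by positivity)
  have hcont : Continuous fun ω : Metric.sphere (0 : EuclideanSpace ℝ (Fin (n + 1))) 1 =>
      u (x + r • (ω : EuclideanSpace ℝ (Fin (n + 1)))) := by fun_prop
  have hpos : 0 < (volume : Measure (EuclideanSpace ℝ (Fin (n + 1)))).toSphere.real Set.univ :=
    ENNReal.toReal_pos (Measure.measure_univ_ne_zero.2 (Measure.toSphere_ne_zero _))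
      (measure_ne_top _ _)
  have hm := hu_submean x r hr
  rw [show ((n + 1 : ℕ) : ℝ) - 1 = n by push_cast; ring,
    setAverage_sphere_eq n.cast_nonneg u x hr,
    average_hausdorffMeasure_sphere_eq_toSphere hcont, average_eq, smul_eq_mul,
    inv_mul_le_iff₀ hpos] at hm
  rw [integral_sub (hcont.integrable_of_hasCompactSupport (.of_compactSpace _))
    (integrable_const _), integral_const, smul_eq_mul]
  linarith
end
end

section
/- Let u : ℝ^N → [0,∞) be lower semicontinuous, locally bounded, with ∫_{ℝ^N} |u(y)|·(1+|y|)^{-(N+α)} dy < ∞, and suppose u is superharmonic in the classical sense: for every x ∈ ℝ^N and every r > 0 the average of u over the ball B(x,r) with respect to Lebesgue measure is at most u(x). Then Δ^{α/2}u ≤ 0 holds in the distributional sense on ℝ^N, i.e. ∫_{ℝ^N} u(x)·Δ^{α/2}θ(x) dx ≤ 0 for every nonnegative θ ∈ C_c^∞(ℝ^N). -/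
open MeasureTheory Real Filter Topology

noncomputable section

/-- The constant `c_{N,-α} = 2^α · π^{-N/2} · Γ((N+α)/2) / |Γ(-α/2)|`. -/
def fracLapCoeff (N : ℕ) (α : ℝ) : ℝ :=
  2 ^ α * Real.pi ^ (-(N : ℝ) / 2) * Real.Gamma (((N : ℝ) + α) / 2) / |Real.Gamma (-α / 2)|

/-- The fractional Laplacian `Δ^{α/2}θ` of a test function `θ`, defined via the
second-difference formula. -/
def fracLap (N : ℕ) (α : ℝ) (θ : EuclideanSpace ℝ (Fin N) → ℝ)
    (x : EuclideanSpace ℝ (Fin N)) : ℝ :=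
  (fracLapCoeff N α / 2) *
    ∫ z : EuclideanSpace ℝ (Fin N), (θ (x + z) + θ (x - z) - 2 * θ x) / ‖z‖ ^ ((N : ℝ) + α)

section Helpers

variable {E : Type*} [NormedAddCommGroup E] [InnerProductSpace ℝ E] [FiniteDimensional ℝ E]
  [MeasurableSpace E] [BorelSpace E]

/-- A locally bounded measurable function is integrable on balls. -/
lemma integrableOn_ball_of_locally_bounded {u : E → ℝ} (hu : Measurable u)
    (hb : ∀ R : ℝ, ∃ M : ℝ, ∀ x : E, ‖x‖ ≤ R → |u x| ≤ M) (x : E) (r : ℝ) :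
    IntegrableOn u (Metric.ball x r) := by
  obtain ⟨M, hM⟩ := hb (‖x‖ + r)
  refine Measure.integrableOn_of_bounded (M := M) measure_ball_lt_top.ne
    hu.aestronglyMeasurable ?_
  filter_upwards [ae_restrict_mem measurableSet_ball] with y hy
  refine hM y ?_
  have h1 : ‖y - x‖ < r := by simpa [dist_eq_norm] using hy
  have h2 := norm_add_le x (y - x)
  rw [add_sub_cancel] at h2
  linarith

lemma lintegral_ball_le_of_average_le {u : E → ℝ} {x : E} {r : ℝ} (hu : ∀ y, 0 ≤ u y)
    (hi : IntegrableOn u (Metric.ball x r)) (hr : 0 < r)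
    (h : ⨍ y in Metric.ball x r, u y ≤ u x) :
    ∫⁻ y in Metric.ball x r, ENNReal.ofReal (u y) ≤
      ENNReal.ofReal (u x) * volume (Metric.ball x r) := by
  have hpos : 0 < volume.real (Metric.ball x r) :=
    ENNReal.toReal_pos (Metric.measure_ball_pos volume x hr).ne' measure_ball_lt_top.ne
  rw [setAverage_eq, smul_eq_mul, inv_mul_le_iff₀ hpos] at h
  rw [← ofReal_integral_eq_lintegral_ofReal hi (ae_of_all _ hu)]
  refine (ENNReal.ofReal_le_ofReal h).trans ?_
  rw [mul_comm, ENNReal.ofReal_mul (hu x), Measure.real,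
    ENNReal.ofReal_toReal measure_ball_lt_top.ne]

lemma lt_add_rpow_neg_iff {ε p t s : ℝ} (hε : 0 < ε) (hp : 0 < p) (ht : 0 < t) (hs : 0 ≤ s) :
    t < (ε + s) ^ (-p) ↔ s < t ^ (-p⁻¹) - ε := by
  have hpos : 0 < ε + s := by linarith
  have h := Real.rpow_lt_rpow_iff_of_neg (Real.rpow_pos_of_pos ht (-p⁻¹)) hpos (neg_lt_zero.2 hp)
  rw [← Real.rpow_mul ht.le, neg_mul_neg, inv_mul_cancel₀ hp.ne', Real.rpow_one] at h
  rw [h]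
  constructor <;> intro h' <;> linarith

/-- Averaging a superharmonic function against a radially decreasing kernel. -/
lemma lintegral_mul_kernel_le {u : E → ℝ} (hum : Measurable u) {x : E}
    (hball : ∀ r, 0 < r → ∫⁻ y in Metric.ball x r, ENNReal.ofReal (u y) ≤
      ENNReal.ofReal (u x) * volume (Metric.ball x r))
    {ε p : ℝ} (hε : 0 < ε) (hp : 0 < p) :
    ∫⁻ y, ENNReal.ofReal (u y) * ENNReal.ofReal ((ε + ‖y - x‖) ^ (-p)) ≤
      ENNReal.ofReal (u x) * ∫⁻ z : E, ENNReal.ofReal ((ε + ‖z‖) ^ (-p)) := by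
  have hf : Measurable fun y : E => (ε + ‖y - x‖) ^ (-p) := by fun_prop
  have h0 : ∀ y : E, 0 ≤ (ε + ‖y - x‖) ^ (-p) := fun y => by positivity
  have h1 := lintegral_withDensity_eq_lintegral_mul₀ (μ := (volume : Measure E))
    hum.ennreal_ofReal.aemeasurable hf.ennreal_ofReal.aemeasurable
  simp only [Pi.mul_apply] at h1
  rw [← h1, lintegral_eq_lintegral_meas_lt _ (ae_of_all _ h0) hf.aemeasurable,
    ← lintegral_sub_right_eq_self (fun z : E => ENNReal.ofReal ((ε + ‖z‖) ^ (-p))) x,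
    lintegral_eq_lintegral_meas_lt _ (ae_of_all _ h0) hf.aemeasurable,
    ← lintegral_const_mul' _ _ ENNReal.ofReal_ne_top]
  refine setLIntegral_mono' measurableSet_Ioi fun t ht => ?_
  have hset : {a : E | t < (ε + ‖a - x‖) ^ (-p)} = Metric.ball x (t ^ (-p⁻¹) - ε) := by
    ext a
    simp only [Set.mem_ofPred_eq, Metric.mem_ball, dist_eq_norm]
    exact lt_add_rpow_neg_iff hε hp ht (norm_nonneg _)
  rw [hset, withDensity_apply _ measurableSet_ball]
  rcases le_or_gt (t ^ (-p⁻¹) - ε) 0 with h | h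
  · simp [Metric.ball_eq_empty.2 h]
  · exact hball _ h

lemma integrable_add_norm_rpow_neg {ε p : ℝ} (hε : 0 < ε) (hp : (Module.finrank ℝ E : ℝ) < p) :
    Integrable fun z : E => (ε + ‖z‖) ^ (-p) := by
  have hp0 : 0 < p := (Nat.cast_nonneg _).trans_lt hp
  have hm : 0 < min 1 ε := lt_min one_pos hε
  refine ((integrable_one_add_norm (μ := (volume : Measure E)) hp).const_mul
    ((min 1 ε) ^ (-p))).mono'
      (Measurable.aestronglyMeasurable (by fun_prop)) (ae_of_all _ fun z => ?_)
  rw [Real.norm_of_nonneg (by positivity), ← Real.mul_rpow hm.le (by positivity)]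
  refine Real.rpow_le_rpow_of_nonpos (by positivity) ?_ (by linarith)
  have h1 : min 1 ε ≤ 1 := min_le_left _ _
  have h2 : min 1 ε ≤ ε := min_le_right _ _
  nlinarith [norm_nonneg z]

/-- Moving a superharmonic average from `u` to the test function. -/
lemma lintegral_shift_le {u θ κ : E → ℝ} (hum : Measurable u) (hu : ∀ x, 0 ≤ u x)
    (hθm : Measurable θ) (hθ : ∀ x, 0 ≤ θ x) (hκm : Measurable κ)
    (heven : ∀ z, κ (-z) = κ z)
    (h : ∀ x, ∫⁻ y, ENNReal.ofReal (u y) * ENNReal.ofReal (κ (y - x)) ≤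
      ENNReal.ofReal (u x) * ∫⁻ z, ENNReal.ofReal (κ z)) :
    ∫⁻ q : E × E, ENNReal.ofReal (u q.1 * (θ (q.1 + q.2) * κ q.2)) ≤
      ∫⁻ q : E × E, ENNReal.ofReal (u q.1 * (θ q.1 * κ q.2)) := by
  rw [Measure.volume_eq_prod, lintegral_prod _ (by fun_prop), lintegral_prod _ (by fun_prop)]
  have h1 : ∀ x : E, ∫⁻ z, ENNReal.ofReal (u x * (θ (x + z) * κ z)) =
      ∫⁻ y, ENNReal.ofReal (u x * (θ y * κ (y - x))) := fun x => by
    simpa using lintegral_add_left_eq_self (fun y => ENNReal.ofReal (u x * (θ y * κ (y - x)))) x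
  simp only [h1]
  rw [lintegral_lintegral_swap (by fun_prop)]
  refine lintegral_mono fun y => ?_
  simp only [ENNReal.ofReal_mul (hu _), ENNReal.ofReal_mul (hθ _)]
  rw [lintegral_const_mul' _ _ ENNReal.ofReal_ne_top, lintegral_const_mul' _ _ ENNReal.ofReal_ne_top,
    mul_left_comm]
  calc _ = ∫⁻ x, ENNReal.ofReal (θ y) * (ENNReal.ofReal (u x) * ENNReal.ofReal (κ (x - y))) := by
        refine lintegral_congr fun x => ?_
        rw [mul_left_comm, ← neg_sub, heven]
    _ ≤ _ := by
        rw [lintegral_const_mul' _ _ ENNReal.ofReal_ne_top]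
        gcongr
        exact h y

omit [FiniteDimensional ℝ E] [MeasurableSpace E] [BorelSpace E] in
/-- A quadratic bound for the symmetric second difference. -/
lemma exists_second_difference_bound {θ : E → ℝ} (hθ : ContDiff ℝ 2 θ)
    (hc : HasCompactSupport θ) :
    ∃ C : ℝ, 0 ≤ C ∧ ∀ x z, |θ (x + z) + θ (x - z) - 2 * θ x| ≤ C * ‖z‖ ^ 2 := by
  obtain ⟨C, hC⟩ := ContDiff.lipschitzWith_of_hasCompactSupport (hc.fderiv ℝ)
    (hθ.fderiv_right (m := 1) (by norm_num)) one_ne_zero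
  have hd : Differentiable ℝ θ := hθ.differentiable two_ne_zero
  refine ⟨2 * C, by positivity, fun x z => ?_⟩
  have key := (convex_closedBall (0 : E) ‖z‖).norm_image_sub_le_of_norm_hasFDerivWithin_le
    (f := fun w => θ (x + w) + θ (x - w))
    (f' := fun w => fderiv ℝ θ (x + w) - fderiv ℝ θ (x - w)) (C := 2 * C * ‖z‖)
    (x := 0) (y := z) (fun w _ => ?_) (fun w hw => ?_) (by simp) (by simp)
  · simp only [add_zero, sub_zero, Real.norm_eq_abs] at key
    rw [show θ (x + z) + θ (x - z) - 2 * θ x = θ (x + z) + θ (x - z) - (θ x + θ x) by ring]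
    exact key.trans_eq (by ring)
  · have h1 : HasFDerivAt (fun w => θ (x + w)) (fderiv ℝ θ (x + w)) w :=
      (hasFDerivAt_comp_add_left x).2 (hd (x + w)).hasFDerivAt
    have h2 : HasFDerivAt (fun w => θ (x - w)) (-fderiv ℝ θ (x - w)) w := by
      have h3 := (hd (x - w)).hasFDerivAt.comp w ((hasFDerivAt_id w).const_sub x)
      rw [ContinuousLinearMap.comp_neg, ContinuousLinearMap.comp_id] at h3
      exact h3
    rw [sub_eq_add_neg]
    exact (h1.add h2).hasFDerivWithinAt
  · have h1 := hC.dist_le_mul (x + w) (x - w)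
    rw [dist_eq_norm, dist_eq_norm] at h1
    refine h1.trans ?_
    have hw' : ‖w‖ ≤ ‖z‖ := by simpa using hw
    have h2 : ‖x + w - (x - w)‖ ≤ 2 * ‖w‖ := by
      rw [show x + w - (x - w) = w + w by abel, two_mul]
      exact norm_add_le _ _
    have h3 := mul_le_mul_of_nonneg_left h2 C.2
    have h4 := mul_le_mul_of_nonneg_left hw' C.2
    simp only [NNReal.val_eq_coe] at h3 h4
    nlinarith

lemma integrableOn_ball_norm_rpow [Nontrivial E] {s : ℝ} (hs : -(Module.finrank ℝ E : ℝ) < s)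
    (r : ℝ) : IntegrableOn (fun z : E => ‖z‖ ^ s) (Metric.ball 0 r) := by
  rcases le_or_gt r 0 with hr | hr
  · simp [Metric.ball_eq_empty.2 hr]
  have hd : 1 ≤ Module.finrank ℝ E := Module.finrank_pos
  rw [integrableOn_fun_norm_addHaar volume (f := fun y => y ^ s)]
  have h1 : IntegrableOn (fun y : ℝ => y ^ (((Module.finrank ℝ E - 1 : ℕ) : ℝ) + s))
      (Set.Ioo 0 r) := by
    rw [intervalIntegral.integrableOn_Ioo_rpow_iff hr]
    push_cast [hd]
    linarith
  refine h1.congr_fun (fun y hy => ?_) measurableSet_Ioo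
  simp only [smul_eq_mul]
  rw [Real.rpow_add hy.1, Real.rpow_natCast]

lemma integrable_shift_and_integral_le {u θ κ : E → ℝ} (hum : Measurable u) (hu : ∀ x, 0 ≤ u x)
    (hθm : Measurable θ) (hθ : ∀ x, 0 ≤ θ x) (hκi : Integrable κ) (hκm : Measurable κ)
    (hκ : ∀ z, 0 ≤ κ z) (heven : ∀ z, κ (-z) = κ z) (huθ : Integrable fun x => u x * θ x)
    (h : ∀ x, ∫⁻ y, ENNReal.ofReal (u y) * ENNReal.ofReal (κ (y - x)) ≤
      ENNReal.ofReal (u x) * ∫⁻ z, ENNReal.ofReal (κ z)) :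
    Integrable (fun q : E × E => u q.1 * (θ q.1 * κ q.2)) ∧
    Integrable (fun q : E × E => u q.1 * (θ (q.1 + q.2) * κ q.2)) ∧
    ∫ q : E × E, u q.1 * (θ (q.1 + q.2) * κ q.2) ≤ ∫ q : E × E, u q.1 * (θ q.1 * κ q.2) := by
  have h1 : Integrable (fun q : E × E => u q.1 * (θ q.1 * κ q.2)) := by
    rw [Measure.volume_eq_prod]
    simpa only [mul_assoc] using huθ.mul_prod hκi
  have h0 : ∀ q : E × E, 0 ≤ u q.1 * (θ q.1 * κ q.2) := fun q =>
    mul_nonneg (hu _) (mul_nonneg (hθ _) (hκ _))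
  have h0' : ∀ q : E × E, 0 ≤ u q.1 * (θ (q.1 + q.2) * κ q.2) := fun q =>
    mul_nonneg (hu _) (mul_nonneg (hθ _) (hκ _))
  have hm : Measurable (fun q : E × E => u q.1 * (θ (q.1 + q.2) * κ q.2)) := by fun_prop
  have hle := lintegral_shift_le hum hu hθm hθ hκm heven h
  have hfin := (hasFiniteIntegral_iff_ofReal (ae_of_all _ h0)).1 h1.2
  refine ⟨h1, ⟨hm.aestronglyMeasurable,
    (hasFiniteIntegral_iff_ofReal (ae_of_all _ h0')).2 (hle.trans_lt hfin)⟩, ?_⟩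
  rw [integral_eq_lintegral_of_nonneg_ae (ae_of_all _ h0) h1.1,
    integral_eq_lintegral_of_nonneg_ae (ae_of_all _ h0') hm.aestronglyMeasurable]
  exact ENNReal.toReal_mono hfin.ne hle

/-- The bilinear form of a superharmonic function and a test function for an integrable kernel
is nonpositive. -/
lemma integral_second_difference_nonpos {u θ κ : E → ℝ} (hum : Measurable u)
    (hu : ∀ x, 0 ≤ u x) (hθm : Measurable θ) (hθ : ∀ x, 0 ≤ θ x) (hκi : Integrable κ)
    (hκm : Measurable κ) (hκ : ∀ z, 0 ≤ κ z) (heven : ∀ z, κ (-z) = κ z)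
    (huθ : Integrable fun x => u x * θ x)
    (h : ∀ x, ∫⁻ y, ENNReal.ofReal (u y) * ENNReal.ofReal (κ (y - x)) ≤
      ENNReal.ofReal (u x) * ∫⁻ z, ENNReal.ofReal (κ z)) :
    Integrable (fun q : E × E => u q.1 * ((θ (q.1 + q.2) + θ (q.1 - q.2) + 2 * θ q.1) * κ q.2)) ∧
    ∫ q : E × E, u q.1 * ((θ (q.1 + q.2) + θ (q.1 - q.2) - 2 * θ q.1) * κ q.2) ≤ 0 := by
  obtain ⟨h1, h2, h3⟩ :=
    integrable_shift_and_integral_le hum hu hθm hθ hκi hκm hκ heven huθ h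
  have hmp : MeasurePreserving (Prod.map id Neg.neg : E × E → E × E) :=
    (MeasurePreserving.id volume).prod (Measure.measurePreserving_neg volume)
  have hemb : MeasurableEmbedding (Prod.map id Neg.neg : E × E → E × E) :=
    ((MeasurableEquiv.refl E).prodCongr (MeasurableEquiv.neg E)).measurableEmbedding
  have h4 : (fun q : E × E => u q.1 * (θ (q.1 - q.2) * κ q.2)) =
      (fun q : E × E => u q.1 * (θ (q.1 + q.2) * κ q.2)) ∘ Prod.map id Neg.neg := by
    ext q
    simp [heven, sub_eq_add_neg]
  have h5 : Integrable (fun q : E × E => u q.1 * (θ (q.1 - q.2) * κ q.2)) := by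
    rw [h4]
    exact (hmp.integrable_comp_emb hemb).2 h2
  have h6 : ∫ q : E × E, u q.1 * (θ (q.1 - q.2) * κ q.2) =
      ∫ q : E × E, u q.1 * (θ (q.1 + q.2) * κ q.2) := by
    rw [h4]
    exact hmp.integral_comp hemb fun q : E × E => u q.1 * (θ (q.1 + q.2) * κ q.2)
  constructor
  · have h7 : ∀ q : E × E, u q.1 * ((θ (q.1 + q.2) + θ (q.1 - q.2) + 2 * θ q.1) * κ q.2) =
        u q.1 * (θ (q.1 + q.2) * κ q.2) + u q.1 * (θ (q.1 - q.2) * κ q.2) +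
          2 * (u q.1 * (θ q.1 * κ q.2)) := fun q => by ring
    simp only [h7]
    exact (h2.fun_add h5).fun_add (h1.const_mul 2)
  · have h7 : ∀ q : E × E, u q.1 * ((θ (q.1 + q.2) + θ (q.1 - q.2) - 2 * θ q.1) * κ q.2) =
        u q.1 * (θ (q.1 + q.2) * κ q.2) + u q.1 * (θ (q.1 - q.2) * κ q.2) -
          2 * (u q.1 * (θ q.1 * κ q.2)) := fun q => by ring
    simp only [h7]
    rw [integral_sub (h2.fun_add h5) (h1.const_mul 2), integral_add h2 h5, integral_const_mul, h6]
    linarith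

lemma integrable_and_integral_second_difference_riesz_nonpos [Nontrivial E] {u θ : E → ℝ}
    {p : ℝ} (hp : (Module.finrank ℝ E : ℝ) < p) (hp2 : p < Module.finrank ℝ E + 2)
    (hum : Measurable u) (hu : ∀ x, 0 ≤ u x)
    (hb : ∀ R : ℝ, ∃ M : ℝ, ∀ x : E, ‖x‖ ≤ R → |u x| ≤ M)
    (hs : ∀ (x : E) (r : ℝ), 0 < r → ⨍ y in Metric.ball x r, u y ≤ u x)
    (hθs : ContDiff ℝ 2 θ) (hθc : HasCompactSupport θ) (hθ : ∀ x, 0 ≤ θ x) :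
    Integrable (fun q : E × E =>
      u q.1 * ((θ (q.1 + q.2) + θ (q.1 - q.2) - 2 * θ q.1) * ‖q.2‖ ^ (-p))) ∧
    ∫ q : E × E, u q.1 * ((θ (q.1 + q.2) + θ (q.1 - q.2) - 2 * θ q.1) * ‖q.2‖ ^ (-p)) ≤ 0 := by
  have hp0 : 0 < p := (Nat.cast_nonneg _).trans_lt hp
  have hui := integrableOn_ball_of_locally_bounded hum hb
  have hθm : Measurable θ := hθs.continuous.measurable
  obtain ⟨R, hR⟩ := hθc.isCompact.isBounded.subset_ball (0 : E)
  have hθ0 : ∀ x : E, R ≤ ‖x‖ → θ x = 0 := fun x hx => by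
    refine image_eq_zero_of_notMem_tsupport fun hx' => ?_
    have := hR hx'
    rw [mem_ball_zero_iff] at this
    linarith
  obtain ⟨B, hB⟩ := hθc.exists_bound_of_continuous hθs.continuous
  have huθ : Integrable fun x => u x * θ x := by
    have h1 : IntegrableOn (fun x => u x * θ x) (Metric.ball 0 R) :=
      Integrable.mul_bdd (c := B) (hui 0 R) hθm.aestronglyMeasurable (ae_of_all _ hB)
    refine (integrableOn_iff_integrable_of_support_subset fun x hx => ?_).1 h1
    by_contra hx'
    rw [mem_ball_zero_iff, not_lt] at hx'
    exact hx (by simp [hθ0 x hx'])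
  have hker : ∀ ε : ℝ, 0 < ε → _ := fun ε hε =>
    integral_second_difference_nonpos (κ := fun z : E => (ε + ‖z‖) ^ (-p)) hum hu hθm hθ
      (integrable_add_norm_rpow_neg hε hp) (by fun_prop) (fun z => by positivity)
      (fun z => by simp) huθ
      (fun x => lintegral_mul_kernel_le hum
        (fun r hr => lintegral_ball_le_of_average_le hu (hui x r) hr (hs x r hr)) hε hp0)
  obtain ⟨C, hC0, hC⟩ := exists_second_difference_bound hθs hθc
  set F : E × E → ℝ := fun q =>
    u q.1 * ((θ (q.1 + q.2) + θ (q.1 - q.2) - 2 * θ q.1) * ‖q.2‖ ^ (-p)) with hF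
  have hFm : Measurable F := by fun_prop
  have hnear : Integrable fun q : E × E =>
      (Metric.ball (0 : E) (R + 1)).indicator u q.1 *
        (Metric.ball (0 : E) 1).indicator (fun z => ‖z‖ ^ (2 - p)) q.2 :=
    ((integrable_indicator_iff measurableSet_ball).2 (hui 0 (R + 1))).mul_prod
      ((integrable_indicator_iff measurableSet_ball).2
        (integrableOn_ball_norm_rpow (by linarith) 1))
  have hfar := (hker 1 one_pos).1
  have hFi : Integrable F := by
    refine ((hnear.const_mul C).add (hfar.const_mul (2 ^ p))).mono' hFm.aestronglyMeasurable
      (ae_of_all _ fun q => ?_)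
    obtain ⟨x, z⟩ := q
    simp only [hF, Pi.add_apply, Real.norm_eq_abs, abs_mul, abs_of_nonneg (hu x),
      abs_of_nonneg (Real.rpow_nonneg (norm_nonneg z) (-p))]
    have hn1 : 0 ≤ C * ((Metric.ball (0 : E) (R + 1)).indicator u x *
        (Metric.ball (0 : E) 1).indicator (fun z => ‖z‖ ^ (2 - p)) z) :=
      mul_nonneg hC0 (mul_nonneg (Set.indicator_nonneg (fun y _ => hu y) _)
        (Set.indicator_nonneg (fun y _ => by positivity) _))
    have hsum : 0 ≤ θ (x + z) + θ (x - z) + 2 * θ x := by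
      linarith [hθ (x + z), hθ (x - z), hθ x]
    have hn2 : 0 ≤ 2 ^ p * (u x * ((θ (x + z) + θ (x - z) + 2 * θ x) * (1 + ‖z‖) ^ (-p))) :=
      mul_nonneg (by positivity) (mul_nonneg (hu x) (mul_nonneg hsum (by positivity)))
    rcases lt_or_ge ‖z‖ 1 with hz | hz
    · refine le_trans ?_ (le_add_of_nonneg_right hn2)
      rcases lt_or_ge ‖x‖ (R + 1) with hx | hx
      · rw [Set.indicator_of_mem (by simpa using hx), Set.indicator_of_mem (by simpa using hz)]
        rcases (norm_nonneg z).eq_or_lt with h0 | h0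
        · have h00 : z = 0 := norm_eq_zero.1 h0.symm
          have : θ x + θ x - 2 * θ x = 0 := by ring
          simp only [h00, add_zero, sub_zero, this, abs_zero, zero_mul, mul_zero]
          exact mul_nonneg hC0 (mul_nonneg (hu x) (by positivity))
        · have h3 : ‖z‖ ^ (2 - p) = ‖z‖ ^ 2 * ‖z‖ ^ (-p) := by
            rw [sub_eq_add_neg, Real.rpow_add h0, Real.rpow_two]
          calc _ ≤ u x * (C * ‖z‖ ^ 2 * ‖z‖ ^ (-p)) := by
                have := hC x z
                have := hu x
                gcongr
            _ = _ := by rw [h3]; ring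
      · have e1 : θ (x + z) = 0 := hθ0 _ (by
          have := norm_sub_norm_le x (-z)
          rw [norm_neg, sub_neg_eq_add] at this
          linarith)
        have e2 : θ (x - z) = 0 := hθ0 _ (by
          have := norm_sub_norm_le x z
          linarith)
        have e3 : θ x = 0 := hθ0 _ (by linarith)
        simpa [e1, e2, e3] using hn1
    · refine le_trans ?_ (le_add_of_nonneg_left hn1)
      have h3 : ‖z‖ ^ (-p) ≤ 2 ^ p * (1 + ‖z‖) ^ (-p) := by
        have h4 : (2 : ℝ) ^ p = (2⁻¹ : ℝ) ^ (-p) := by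
          rw [Real.inv_rpow zero_le_two, Real.rpow_neg zero_le_two, inv_inv]
        rw [h4, ← Real.mul_rpow (by norm_num) (by positivity)]
        exact Real.rpow_le_rpow_of_nonpos (by positivity) (by linarith) (by linarith)
      have h5 : |θ (x + z) + θ (x - z) - 2 * θ x| ≤ θ (x + z) + θ (x - z) + 2 * θ x := by
        rw [abs_le]
        constructor <;> linarith [hθ (x + z), hθ (x - z), hθ x]
      calc _ ≤ u x * ((θ (x + z) + θ (x - z) + 2 * θ x) * (2 ^ p * (1 + ‖z‖) ^ (-p))) := by
            have := hu x
            gcongr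
        _ = _ := by ring
  refine ⟨hFi, ?_⟩
  have hlim := tendsto_integral_of_dominated_convergence (μ := (volume : Measure (E × E)))
    (F := fun (n : ℕ) (q : E × E) => u q.1 *
      ((θ (q.1 + q.2) + θ (q.1 - q.2) - 2 * θ q.1) * (1 / ((n : ℝ) + 1) + ‖q.2‖) ^ (-p)))
    (f := F) (fun q => ‖F q‖) (fun n => Measurable.aestronglyMeasurable (by fun_prop)) hFi.norm
    (fun n => ae_of_all _ fun q => ?_) (ae_of_all _ fun q => ?_)
  · exact le_of_tendsto' hlim fun n => (hker (1 / ((n : ℝ) + 1)) (by positivity)).2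
  · simp only [hF, norm_mul]
    rcases (norm_nonneg q.2).eq_or_lt with h0 | h0
    · have h00 : q.2 = 0 := norm_eq_zero.1 h0.symm
      have : θ q.1 + θ q.1 - 2 * θ q.1 = 0 := by ring
      simp [h00, this]
    · gcongr _ * (_ * ?_)
      rw [Real.norm_of_nonneg (by positivity), Real.norm_of_nonneg (by positivity)]
      exact Real.rpow_le_rpow_of_nonpos h0 (le_add_of_nonneg_left (by positivity)) (by linarith)
  · rcases (norm_nonneg q.2).eq_or_lt with h0 | h0
    · have h00 : q.2 = 0 := norm_eq_zero.1 h0.symm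
      have : θ q.1 + θ q.1 - 2 * θ q.1 = 0 := by ring
      simp [hF, h00, this]
    · refine Tendsto.const_mul _ (Tendsto.const_mul _ ?_)
      have h1 : Tendsto (fun n : ℕ => 1 / ((n : ℝ) + 1) + ‖q.2‖) atTop (𝓝 ‖q.2‖) := by
        simpa using (tendsto_one_div_add_atTop_nhds_zero_nat (𝕜 := ℝ)).add_const ‖q.2‖
      exact h1.rpow_const (Or.inl h0.ne')

end Helpers

lemma fracLapCoeff_nonneg (N : ℕ) {α : ℝ} (hα : 0 < α) : 0 ≤ fracLapCoeff N α := by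
  unfold fracLapCoeff
  have : 0 < Real.Gamma (((N : ℝ) + α) / 2) := Real.Gamma_pos_of_pos (by positivity)
  positivity

/-- a nonnegative lower semicontinuous, locally bounded, classically
superharmonic function (ball sub-mean-value property) is `α`-superharmonic in the
distributional sense. -/
theorem stmt1 (N : ℕ) (hN : 3 ≤ N) (α : ℝ) (hα1 : 0 < α) (hα2 : α < 2)
    (u : EuclideanSpace ℝ (Fin N) → ℝ)
    (hu_lsc : LowerSemicontinuous u)
    (hu_nn : ∀ x, 0 ≤ u x)
    (hu_locb : ∀ R : ℝ, ∃ M : ℝ, ∀ x : EuclideanSpace ℝ (Fin N), ‖x‖ ≤ R → |u x| ≤ M)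
    (hu_int : Integrable (fun y : EuclideanSpace ℝ (Fin N) =>
      |u y| * (1 + ‖y‖) ^ (-((N : ℝ) + α))))
    (hu_super : ∀ (x : EuclideanSpace ℝ (Fin N)) (r : ℝ), 0 < r →
      ⨍ y in Metric.ball x r, u y ≤ u x) :
    ∀ θ : EuclideanSpace ℝ (Fin N) → ℝ, ContDiff ℝ (⊤ : ℕ∞) θ → HasCompactSupport θ →
      (∀ x, 0 ≤ θ x) →
      (∫ x, u x * fracLap N α θ x) ≤ 0 := by
  intro θ hθs hθc hθ
  have : Nontrivial (EuclideanSpace ℝ (Fin N)) := by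
    rw [← Module.finrank_pos_iff (R := ℝ), finrank_euclideanSpace_fin]
    omega
  obtain ⟨hi, hle⟩ := integrable_and_integral_second_difference_riesz_nonpos
    (E := EuclideanSpace ℝ (Fin N)) (p := N + α) (by simpa using hα1) (by simpa using hα2)
    hu_lsc.measurable hu_nn hu_locb hu_super (hθs.of_le (WithTop.coe_le_coe.2 le_top)) hθc hθ
  rw [Measure.volume_eq_prod] at hi hle
  rw [integral_prod _ hi] at hle
  have h1 : ∀ x, u x * fracLap N α θ x = fracLapCoeff N α / 2 *
      ∫ z, u x * ((θ (x + z) + θ (x - z) - 2 * θ x) * ‖z‖ ^ (-((N : ℝ) + α))) := fun x => by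
    rw [fracLap, integral_const_mul, mul_left_comm]
    simp only [Real.rpow_neg (norm_nonneg _), div_eq_mul_inv]
  simp only [h1]
  rw [integral_const_mul]
  exact mul_nonpos_of_nonneg_of_nonpos (div_nonneg (fracLapCoeff_nonneg N hα1) zero_le_two) hle
end
end
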